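/- Let Σ be an alphabet of size k ≥ 2 and let L be a finite language over Σ accepted by a partial DFA with m states. Let l be the smallest nonnegative integer such that 2^{m−l} ≤ k^l. Then the reversal L^R is accepted by a partial DFA with at most Σ_{i=0}^{l−1} k^i + 2^{m−l} − 1 states; in particular isc(L^R) ≤ Σ_{i=0}^{l−1} k^i + 2^{m−l} − 1. -/

import Mathlib

open scoped Computability
open scoped Classical

/-- A partial DFA over alphabet `α` with state set `Fin n`. -/
structure PDFA (α : Type) (n : ℕ) where
  step : Fin n → α → Option (Fin n)
  start : Fin n
  accept : Finset (Fin n)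

namespace PDFA

variable {α : Type} {n : ℕ}

/-- Run the partial DFA from a state along a word; `none` if a transition is undefined. -/
def evalFrom (M : PDFA α n) : Fin n → List α → Option (Fin n)
  | q, [] => some q
  | q, a :: w => (M.step q a).bind fun q' => M.evalFrom q' w

/-- The language accepted by a partial DFA. -/
def lang (M : PDFA α n) : Language α :=
  {w | ∃ q ∈ M.accept, M.evalFrom M.start w = some q}

/-- The number of defined transitions. -/
noncomputable def transCount [Fintype α] (M : PDFA α n) : ℕ :=
  (Finset.univ.filter fun p : Fin n × α => (M.step p.1 p.2).isSome).card

/-- The number of defined `τ`-transitions. -/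
noncomputable def transCountOn (M : PDFA α n) (τ : α) : ℕ :=
  (Finset.univ.filter fun q : Fin n => (M.step q τ).isSome).card

/-- `s_τ`: 1 if a `τ`-transition is defined at the initial state, else 0. -/
def sOn (M : PDFA α n) (τ : α) : ℕ := if (M.step M.start τ).isSome then 1 else 0

/-- `s`: total over the alphabet of `s_τ`. -/
noncomputable def sTot [Fintype α] (M : PDFA α n) : ℕ := ∑ τ : α, M.sOn τ

/-- `s̄_τ = 1 - s_τ`. -/
def sbarOn (M : PDFA α n) (τ : α) : ℕ := 1 - M.sOn τ

/-- `a_τ`: the number of defined `τ`-transitions entering a final state. -/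
noncomputable def aOn (M : PDFA α n) (τ : α) : ℕ :=
  (Finset.univ.filter fun p : Fin n => ∃ q ∈ M.accept, M.step p τ = some q).card

/-- `e_τ`: the number of final states at which a `τ`-transition is defined. -/
noncomputable def eOn (M : PDFA α n) (τ : α) : ℕ :=
  (M.accept.filter fun q => (M.step q τ).isSome).card

/-- `ē_τ`: the number of final states at which no `τ`-transition is defined. -/
noncomputable def ebarOn (M : PDFA α n) (τ : α) : ℕ :=
  (M.accept.filter fun q => M.step q τ = none).card

/-- `t̄_τ`: the number of states at which no `τ`-transition is defined. -/
noncomputable def tbarOn (M : PDFA α n) (τ : α) : ℕ :=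
  (Finset.univ.filter fun q : Fin n => M.step q τ = none).card

/-- `f(A)`: the number of final states. -/
def fTot (M : PDFA α n) : ℕ := M.accept.card

/-- `f(A, i)`: the number of final states numbered strictly less than `i`. -/
noncomputable def fBelow (M : PDFA α n) (i : ℕ) : ℕ :=
  (M.accept.filter fun q => (q : ℕ) < i).card

/-- `t̄_τ(L, i)`: 1 if no `τ`-transition is defined at state `i`, else 0. -/
noncomputable def tbarAt (M : PDFA α n) (τ : α) (i : ℕ) : ℕ :=
  if h : i < n then (if M.step ⟨i, h⟩ τ = none then 1 else 0) else 0

/-- The states (numbered by `Fin n`) are topologically ordered: the initial state is `0`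
and every defined transition goes from a smaller-numbered to a larger-numbered state. -/
def Ordered (M : PDFA α n) : Prop :=
  (M.start : ℕ) = 0 ∧ ∀ q a q', M.step q a = some q' → q < q'

end PDFA

/-- The incomplete state complexity: the minimal number of states of a partial DFA
accepting `L`. -/
noncomputable def isc {α : Type} (L : Language α) : ℕ :=
  sInf {m | ∃ M : PDFA α m, M.lang = L}

/-- The incomplete transition complexity: the minimal number of defined transitions
over all partial DFAs accepting `L`. -/
noncomputable def itc {α : Type} [Fintype α] (L : Language α) : ℕ :=
  sInf {t | ∃ m, ∃ M : PDFA α m, M.lang = L ∧ M.transCount = t}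

/-- The minimal number of defined `τ`-transitions over all partial DFAs accepting `L`. -/
noncomputable def itcOn {α : Type} (L : Language α) (τ : α) : ℕ :=
  sInf {t | ∃ m, ∃ M : PDFA α m, M.lang = L ∧ M.transCountOn τ = t}


namespace PDFA

variable {α : Type} {n : ℕ}

theorem evalFrom_append (M : PDFA α n) (q : Fin n) (u v : List α) :
    M.evalFrom q (u ++ v) = (M.evalFrom q u).bind fun p => M.evalFrom p v := by
  induction u generalizing q with
  | nil => rfl
  | cons a u ih =>
    simp only [List.cons_append, evalFrom, Option.bind_assoc]
    congr 1
    funext p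
    exact ih p

/-- The words accepted from the state `q`. -/
def acceptsFrom (M : PDFA α n) (q : Fin n) : Language α :=
  {w | ∃ p ∈ M.accept, M.evalFrom q w = some p}

theorem nil_mem_acceptsFrom (M : PDFA α n) (q : Fin n) :
    [] ∈ M.acceptsFrom q ↔ q ∈ M.accept := by
  change (∃ p ∈ M.accept, some q = some p) ↔ _
  simp

theorem append_mem_acceptsFrom (M : PDFA α n) (q : Fin n) (u v : List α) :
    u ++ v ∈ M.acceptsFrom q ↔ ∃ p, M.evalFrom q u = some p ∧ v ∈ M.acceptsFrom p := by
  change (∃ r ∈ M.accept, M.evalFrom q (u ++ v) = some r) ↔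
    ∃ p, M.evalFrom q u = some p ∧ ∃ r ∈ M.accept, M.evalFrom p v = some r
  simp only [evalFrom_append, Option.bind_eq_some_iff]
  tauto

theorem cons_mem_acceptsFrom (M : PDFA α n) (q : Fin n) (a : α) (v : List α) :
    a :: v ∈ M.acceptsFrom q ↔ ∃ p, M.step q a = some p ∧ v ∈ M.acceptsFrom p := by
  simpa [evalFrom] using M.append_mem_acceptsFrom q [a] v

/-- A finite set of languages containing `K` and all its nonempty left quotients is the state set
of a partial DFA for `K`. -/
theorem exists_lang_eq_of_leftQuotient_mem (K : Language α) (T : Finset (Language α))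
    (hK : K ∈ T) (hT : ∀ w, K.leftQuotient w = 0 ∨ K.leftQuotient w ∈ T) :
    ∃ C : PDFA α T.card, C.lang = K := by
  let e := T.equivFin
  let C : PDFA α T.card :=
    { step := fun q a =>
        if h : (e.symm q : Language α).leftQuotient [a] ∈ T then some (e ⟨_, h⟩) else none
      start := e ⟨K, hK⟩
      accept := Finset.univ.filter fun q => [] ∈ (e.symm q : Language α) }
  have key : ∀ (v u : List α) (q : Fin T.card), (e.symm q : Language α) = K.leftQuotient u →
      (v ∈ C.acceptsFrom q ↔ u ++ v ∈ K) := by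
    intro v
    induction v with
    | nil =>
      intro u q hq
      rw [nil_mem_acceptsFrom, ← Language.mem_leftQuotient, ← hq]
      simp [C]
    | cons a v ih =>
      intro u q hq
      have hs : (e.symm q : Language α).leftQuotient [a] = K.leftQuotient (u ++ [a]) := by
        rw [hq, Language.leftQuotient_append]
      rw [cons_mem_acceptsFrom]
      by_cases h : (e.symm q : Language α).leftQuotient [a] ∈ T
      · have hstep : C.step q a = some (e ⟨_, h⟩) := dif_pos h
        have := ih (u ++ [a]) (e ⟨_, h⟩) (by simpa using hs)
        simpa [hstep] using this
      · have hstep : C.step q a = none := dif_neg h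
        have h0 := (hT (u ++ [a])).resolve_right (hs ▸ h)
        have : v ∉ K.leftQuotient (u ++ [a]) := by rw [h0]; exact Language.notMem_zero v
        simpa [hstep] using this
  refine ⟨C, ?_⟩
  ext v
  exact key v [] C.start (by simp [C])

/-- The accessible states from which some word of length at least `j` is accepted. -/
noncomputable def deepStates (M : PDFA α n) (j : ℕ) : Finset (Fin n) :=
  Finset.univ.filter fun q =>
    (∃ u, M.evalFrom M.start u = some q) ∧ ∃ v ∈ M.acceptsFrom q, j ≤ v.length

theorem mem_deepStates {M : PDFA α n} {j : ℕ} {q : Fin n} : q ∈ M.deepStates j ↔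
    (∃ u, M.evalFrom M.start u = some q) ∧ ∃ v ∈ M.acceptsFrom q, j ≤ v.length := by
  simp [deepStates]

theorem deepStates_succ_subset (M : PDFA α n) (j : ℕ) :
    M.deepStates (j + 1) ⊆ M.deepStates j := by
  intro q
  simp only [mem_deepStates]
  rintro ⟨hu, v, hv, hj⟩
  exact ⟨hu, v, hv, by omega⟩

theorem exists_step_of_mem_deepStates_succ {M : PDFA α n} {j : ℕ} {q : Fin n}
    (hq : q ∈ M.deepStates (j + 1)) : ∃ a, ∃ p ∈ M.deepStates j, M.step q a = some p := by
  obtain ⟨⟨u, hu⟩, v, hv, hj⟩ := mem_deepStates.1 hq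
  cases v with
  | nil => simp at hj
  | cons a v =>
    obtain ⟨p, hp, hv⟩ := (M.cons_mem_acceptsFrom q a v).1 hv
    refine ⟨a, p, mem_deepStates.2 ⟨⟨u ++ [a], ?_⟩, v, hv, by simpa using hj⟩, hp⟩
    simp [evalFrom_append, hu, evalFrom, hp]

/-- In a partial DFA of a finite language, the nonempty sets `deepStates j` strictly decrease. -/
theorem deepStates_succ_ssubset {M : PDFA α n} (hf : Set.Finite {w : List α | w ∈ M.lang})
    {j : ℕ} (hne : (M.deepStates j).Nonempty) : M.deepStates (j + 1) ⊂ M.deepStates j := by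
  refine (M.deepStates_succ_subset j).ssubset_of_ne fun heq => ?_
  have long : ∀ N, ∀ q ∈ M.deepStates j, ∃ v ∈ M.acceptsFrom q, N ≤ v.length := by
    intro N
    induction N with
    | zero =>
      intro q hq
      obtain ⟨-, v, hv, -⟩ := mem_deepStates.1 hq
      exact ⟨v, hv, Nat.zero_le _⟩
    | succ N ih =>
      intro q hq
      obtain ⟨a, p, hp, hstep⟩ := exists_step_of_mem_deepStates_succ (heq ▸ hq)
      obtain ⟨v, hv, hN⟩ := ih p hp
      exact ⟨a :: v, (M.cons_mem_acceptsFrom q a v).2 ⟨p, hstep, hv⟩, by simpa using hN⟩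
  obtain ⟨B, hB⟩ := (hf.image List.length).bddAbove
  obtain ⟨q, hq⟩ := hne
  obtain ⟨⟨u, hu⟩, -⟩ := mem_deepStates.1 hq
  obtain ⟨v, hv, hlen⟩ := long (B + 1) q hq
  have hmem : u ++ v ∈ M.lang := (M.append_mem_acceptsFrom M.start u v).2 ⟨q, hu, hv⟩
  have := hB ⟨u ++ v, hmem, rfl⟩
  simp only [List.length_append] at this
  omega

theorem card_deepStates_le {M : PDFA α n} (hf : Set.Finite {w : List α | w ∈ M.lang}) (j : ℕ) :
    (M.deepStates j).card ≤ n - j := by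
  induction j with
  | zero => simpa using Finset.card_le_univ (M.deepStates 0)
  | succ j ih =>
    by_cases hne : (M.deepStates j).Nonempty
    · have := Finset.card_lt_card (deepStates_succ_ssubset hf hne)
      omega
    · have h0 := M.deepStates_succ_subset j
      rw [Finset.not_nonempty_iff_eq_empty.1 hne, Finset.subset_empty] at h0
      simp [h0]

/-- The words whose reversal leads from the initial state into `S`. -/
def reverseInto (M : PDFA α n) (S : Finset (Fin n)) : Language α :=
  {u | ∃ q ∈ S, M.evalFrom M.start u.reverse = some q}

theorem leftQuotient_reverse_lang (M : PDFA α n) {j : ℕ} {w : List α} (hw : j ≤ w.length) :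
    M.lang.reverse.leftQuotient w =
      M.reverseInto ((M.deepStates j).filter fun q => w.reverse ∈ M.acceptsFrom q) := by
  ext u
  rw [Language.mem_leftQuotient, Language.mem_reverse, List.reverse_append]
  refine (M.append_mem_acceptsFrom M.start _ _).trans ?_
  change _ ↔ ∃ q ∈ _, M.evalFrom M.start u.reverse = some q
  simp only [Finset.mem_filter, mem_deepStates]
  constructor
  · rintro ⟨q, hq, hv⟩
    exact ⟨q, ⟨⟨⟨_, hq⟩, _, hv, by simpa using hw⟩, hv⟩, hq⟩
  · rintro ⟨q, ⟨-, hv⟩, hq⟩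
    exact ⟨q, hq, hv⟩

theorem reverseInto_empty (M : PDFA α n) : M.reverseInto ∅ = 0 := by
  ext u
  change (∃ q ∈ (∅ : Finset (Fin n)), _) ↔ u ∈ (0 : Language α)
  simp [Language.notMem_zero]

end PDFA

/-- The left quotients of `K` by words of length less than `l`. -/
noncomputable def Language.shortQuotients {α : Type} [Fintype α] (K : Language α) (l : ℕ) :
    Finset (Language α) :=
  (Finset.range l).biUnion fun i =>
    Finset.univ.image fun f : Fin i → α => K.leftQuotient (List.ofFn f)

theorem Language.card_shortQuotients_le {α : Type} [Fintype α] (K : Language α) (l : ℕ) :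
    (K.shortQuotients l).card ≤ ∑ i ∈ Finset.range l, Fintype.card α ^ i := by
  refine Finset.card_biUnion_le.trans (Finset.sum_le_sum fun i _ => Finset.card_image_le.trans ?_)
  simp

theorem Language.leftQuotient_mem_shortQuotients {α : Type} [Fintype α] (K : Language α) {l : ℕ}
    {w : List α} (hw : w.length < l) : K.leftQuotient w ∈ K.shortQuotients l := by
  simp only [shortQuotients, Finset.mem_biUnion, Finset.mem_range, Finset.mem_image,
    Finset.mem_univ, true_and]
  exact ⟨w.length, hw, w.get, by simp⟩

/-- If `L` is a finite language over an alphabet of size `k ≥ 2`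
accepted by a partial DFA with `m` states, and `l` is the smallest nonnegative integer
with `2^{m−l} ≤ k^l`, then the reversal `L^R` is accepted by a partial DFA with at most
`Σ_{i=0}^{l−1} k^i + 2^{m−l} − 1` states. -/
theorem reverse_isc_upper {α : Type} [Fintype α] {m l : ℕ} (hk : 2 ≤ Fintype.card α)
    (L : Language α) (hf : Set.Finite {w : List α | w ∈ L})
    (M : PDFA α m) (hM : M.lang = L)
    (hl : 2 ^ (m - l) ≤ (Fintype.card α) ^ l)
    (hlmin : ∀ l' : ℕ, l' < l → ¬ (2 ^ (m - l') ≤ (Fintype.card α) ^ l')) :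
    (∃ k : ℕ, k ≤ (∑ i ∈ Finset.range l, (Fintype.card α) ^ i) + 2 ^ (m - l) - 1 ∧
        ∃ C : PDFA α k, C.lang = L.reverse) ∧
      isc L.reverse ≤ (∑ i ∈ Finset.range l, (Fintype.card α) ^ i) + 2 ^ (m - l) - 1 := by
  subst hM
  have hm : 0 < m := M.start.pos
  have hl0 : 0 < l := by
    rcases Nat.eq_zero_or_pos l with rfl | h
    · have := Nat.one_lt_two_pow hm.ne'
      simp only [Nat.sub_zero, pow_zero] at hl
      omega
    · exact h
  set K := M.lang.reverse with hKdef
  let T : Finset (Language α) :=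
    K.shortQuotients l ∪ ((M.deepStates l).powerset.erase ∅).image M.reverseInto
  have hK : K ∈ T := by
    have := K.leftQuotient_mem_shortQuotients (w := []) hl0
    rw [Language.leftQuotient_nil] at this
    exact Finset.mem_union_left _ this
  have hT : ∀ w, K.leftQuotient w = 0 ∨ K.leftQuotient w ∈ T := by
    intro w
    rcases lt_or_ge w.length l with hw | hw
    · exact .inr (Finset.mem_union_left _ (K.leftQuotient_mem_shortQuotients hw))
    · rw [hKdef, M.leftQuotient_reverse_lang hw]
      rcases Finset.eq_empty_or_nonempty
        ((M.deepStates l).filter fun q => w.reverse ∈ M.acceptsFrom q) with hS | hS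
      · exact .inl (by rw [hS, M.reverseInto_empty])
      · refine .inr (Finset.mem_union_right _ (Finset.mem_image_of_mem _ ?_))
        exact Finset.mem_erase.2
          ⟨hS.ne_empty, Finset.mem_powerset.2 (Finset.filter_subset _ _)⟩
  have hcard : T.card ≤ (∑ i ∈ Finset.range l, Fintype.card α ^ i) + 2 ^ (m - l) - 1 := by
    have hdeep : (((M.deepStates l).powerset.erase ∅).image M.reverseInto).card
        ≤ 2 ^ (m - l) - 1 := by
      refine Finset.card_image_le.trans ?_
      rw [Finset.card_erase_of_mem (Finset.empty_mem_powerset _), Finset.card_powerset]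
      exact Nat.sub_le_sub_right
        (Nat.pow_le_pow_right two_pos (PDFA.card_deepStates_le hf l)) 1
    have hshort := K.card_shortQuotients_le l
    have hunion : T.card ≤ _ := Finset.card_union_le _ _
    have hpos : 0 < 2 ^ (m - l) := Nat.two_pow_pos _
    omega
  have hC := PDFA.exists_lang_eq_of_leftQuotient_mem K T hK hT
  exact ⟨⟨T.card, hcard, hC⟩, (Nat.sInf_le hC).trans hcard⟩
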